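/- arXiv:1809.01498 — 2 statements merged into one kernel-verified Lean document; each statement's English description precedes it below -/
import Mathlib

section
/- Let n ≥ 0, let k ≥ 0, let b_0, …, b_k ∈ ℝ^{n+1}, let θ ∈ ℝ, and let y_0, …, y_k ∈ {0,1}. Define f : ℝ^{n+1} → ℝ by f(p) = Σ_{i=0}^{k} log σ((−1)^{1−y_i}(⟨p, b_i⟩_M + θ)), where σ(x) = 1/(1+e^{−x}) is the logistic sigmoid. Then the Minkowski gradient of f at p equals Σ_{i=0}^{k} (y_i − σ(⟨p, b_i⟩_M + θ)) · b_i. -/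
/-- The Minkowski dot product on ℝ^{n+1}: ⟨u,v⟩_M = Σ_{i<n} uᵢvᵢ − uₙvₙ. -/
noncomputable def mink {n : ℕ} (u v : Fin (n + 1) → ℝ) : ℝ :=
  (∑ i : Fin n, u i.castSucc * v i.castSucc) - u (Fin.last n) * v (Fin.last n)

/-- The hyperboloid model ℍⁿ ⊆ ℝ^{(n,1)}. -/
def Hyperboloid (n : ℕ) : Set (Fin (n + 1) → ℝ) :=
  {x | mink x x = -1 ∧ 0 < x (Fin.last n)}

/-- The tangent space to the hyperboloid at p. -/
def Tangent {n : ℕ} (p : Fin (n + 1) → ℝ) : Set (Fin (n + 1) → ℝ) :=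
  {x | mink x p = 0}

/-- The Minkowski norm ‖v‖ = √⟨v,v⟩_M. -/
noncomputable def mnorm {n : ℕ} (v : Fin (n + 1) → ℝ) : ℝ :=
  Real.sqrt (mink v v)

/-- The normalisation v̂ = v / ‖v‖. -/
noncomputable def munit {n : ℕ} (v : Fin (n + 1) → ℝ) : Fin (n + 1) → ℝ :=
  (mnorm v)⁻¹ • v

/-- The geodesic γ_{p,v}(t) = cosh(‖v‖t)·p + sinh(‖v‖t)·v̂. -/
noncomputable def geo {n : ℕ} (p v : Fin (n + 1) → ℝ) (t : ℝ) : Fin (n + 1) → ℝ :=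
  Real.cosh (mnorm v * t) • p + Real.sinh (mnorm v * t) • munit v

/-- The geodesic velocity γ'_{p,v}(t) = ‖v‖sinh(‖v‖t)·p + ‖v‖cosh(‖v‖t)·v̂. -/
noncomputable def geo' {n : ℕ} (p v : Fin (n + 1) → ℝ) (t : ℝ) : Fin (n + 1) → ℝ :=
  (mnorm v * Real.sinh (mnorm v * t)) • p + (mnorm v * Real.cosh (mnorm v * t)) • munit v

/-- Inverse hyperbolic cosine. -/
noncomputable def arccosh (x : ℝ) : ℝ :=
  Real.log (x + Real.sqrt (x ^ 2 - 1))

/-- Parallel transport of w along the geodesic γ_{p,v}. -/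
noncomputable def ptransp {n : ℕ} (p v w : Fin (n + 1) → ℝ) (t : ℝ) : Fin (n + 1) → ℝ :=
  mink w (munit v) • (Real.sinh (mnorm v * t) • p + Real.cosh (mnorm v * t) • munit v)
    + w - mink w (munit v) • munit v

/-- The Minkowski gradient of f at x. -/
noncomputable def minkGrad {n : ℕ} (f : (Fin (n + 1) → ℝ) → ℝ) (x : Fin (n + 1) → ℝ) :
    Fin (n + 1) → ℝ :=
  fun i => if i = Fin.last n then -(fderiv ℝ f x (Pi.single i 1)) else fderiv ℝ f x (Pi.single i 1)

/-- The logistic sigmoid. -/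
noncomputable def sigmoid (x : ℝ) : ℝ := 1 / (1 + Real.exp (-x))
/-- The continuous linear functional `u ↦ ⟨u, v⟩_M`. -/
noncomputable def minkCLM {n : ℕ} (v : Fin (n + 1) → ℝ) : (Fin (n + 1) → ℝ) →L[ℝ] ℝ :=
  (∑ i : Fin n, v i.castSucc • ContinuousLinearMap.proj i.castSucc)
    - v (Fin.last n) • ContinuousLinearMap.proj (Fin.last n)

lemma minkCLM_apply {n : ℕ} (v u : Fin (n + 1) → ℝ) : minkCLM v u = mink u v := by
  simp [minkCLM, mink, mul_comm]

lemma mink_single_last {n : ℕ} (v : Fin (n + 1) → ℝ) :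
    mink (Pi.single (Fin.last n) 1) v = -v (Fin.last n) := by
  simp [mink, Fin.castSucc_ne_last]

lemma mink_single_castSucc {n : ℕ} (v : Fin (n + 1) → ℝ) (j : Fin n) :
    mink (Pi.single j.castSucc 1) v = v j.castSucc := by
  simp [mink, Pi.single_apply, (Fin.castSucc_ne_last j).symm]

lemma hasFDerivAt_mink_left {n : ℕ} (v p : Fin (n + 1) → ℝ) :
    HasFDerivAt (fun q => mink q v) (minkCLM v) p := by
  simp only [← minkCLM_apply]
  exact (minkCLM v).hasFDerivAt

lemma minkGrad_eq_sum_smul {n : ℕ} {ι : Type*} [Fintype ι] {f : (Fin (n + 1) → ℝ) → ℝ}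
    {p : Fin (n + 1) → ℝ} {c : ι → ℝ} {v : ι → Fin (n + 1) → ℝ}
    (hf : HasFDerivAt f (∑ i, c i • minkCLM (v i)) p) :
    minkGrad f p = ∑ i, c i • v i := by
  funext j
  refine Fin.lastCases ?_ (fun j => ?_) j
  · simp [minkGrad, hf.fderiv, minkCLM_apply, mink_single_last]
  · simp [minkGrad, hf.fderiv, minkCLM_apply, mink_single_castSucc, Fin.castSucc_ne_last]

lemma sigmoid_eq_real_sigmoid : sigmoid = Real.sigmoid := by
  funext x
  rw [sigmoid, Real.sigmoid_def, one_div]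

lemma hasDerivAt_log_sigmoid (x : ℝ) :
    HasDerivAt (fun t => Real.log (sigmoid t)) (1 - sigmoid x) x := by
  rw [sigmoid_eq_real_sigmoid]
  have hx := (Real.sigmoid_pos x).ne'
  convert (Real.hasDerivAt_sigmoid x).log hx using 1
  field_simp

/-- The derivative of the logistic log-likelihood of a label `y ∈ {0, 1}`. -/
lemma hasDerivAt_log_sigmoid_label {y : ℕ} (hy : y = 0 ∨ y = 1) (x : ℝ) :
    HasDerivAt (fun t => Real.log (sigmoid ((-1 : ℝ) ^ (1 - y) * t))) (y - sigmoid x) x := by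
  rcases hy with rfl | rfl
  · have h := (hasDerivAt_log_sigmoid (-x)).comp x (hasDerivAt_neg x)
    rw [sigmoid_eq_real_sigmoid] at h ⊢
    simpa [Real.sigmoid_neg, Function.comp_def] using h
  · simpa using hasDerivAt_log_sigmoid x

/-- The Minkowski gradient of the skip-gram objective w.r.t. the centre-word vector:
∇_p Σᵢ log σ((−1)^{1−yᵢ}(⟨p,bᵢ⟩_M + θ)) = Σᵢ (yᵢ − σ(⟨p,bᵢ⟩_M + θ))·bᵢ. -/
theorem minkGrad_skipgram_centre {n k : ℕ}
    (b : Fin (k + 1) → Fin (n + 1) → ℝ) (θ : ℝ)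
    (y : Fin (k + 1) → ℕ) (hy : ∀ i, y i = 0 ∨ y i = 1)
    (p : Fin (n + 1) → ℝ) :
    minkGrad
        (fun q => ∑ i : Fin (k + 1),
          Real.log (sigmoid ((-1 : ℝ) ^ (1 - y i) * (mink q (b i) + θ)))) p
      = ∑ i : Fin (k + 1), (((y i : ℝ) - sigmoid (mink p (b i) + θ)) • b i) := by
  refine minkGrad_eq_sum_smul (HasFDerivAt.fun_sum fun i _ => ?_)
  exact (hasDerivAt_log_sigmoid_label (hy i) _).comp_hasFDerivAt p
    ((hasFDerivAt_mink_left (b i) p).add_const θ)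
end

section
/- (Theorem 1 of the paper.) Let n ≥ 1, p ∈ ℍⁿ, let v ∈ T_pℍⁿ be nonzero, and let w ∈ T_pℍⁿ. Define the vector field X(t) = ⟨w,v̂⟩_M · (sinh(‖v‖t)·p + cosh(‖v‖t)·v̂) + w − ⟨w,v̂⟩_M · v̂ along the geodesic γ = γ_{p,v}. Then X is parallel along γ with respect to the Levi-Civita connection of the induced metric, i.e. its covariant derivative vanishes: for every t ∈ ℝ, X'(t) − ⟨X(t), γ'(t)⟩_M · γ(t) = 0. -/
theorem mink_comm {n : ℕ} (x y : Fin (n + 1) → ℝ) : mink x y = mink y x := by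
  simp only [mink, mul_comm]

theorem mink_add_left {n : ℕ} (x y z : Fin (n + 1) → ℝ) :
    mink (x + y) z = mink x z + mink y z := by
  simp only [mink, Pi.add_apply, add_mul, Finset.sum_add_distrib]
  ring

theorem mink_smul_left {n : ℕ} (a : ℝ) (x y : Fin (n + 1) → ℝ) :
    mink (a • x) y = a * mink x y := by
  simp only [mink, Pi.smul_apply, smul_eq_mul, mul_assoc, mul_sub, Finset.mul_sum]

theorem mink_sub_left {n : ℕ} (x y z : Fin (n + 1) → ℝ) :
    mink (x - y) z = mink x z - mink y z := by
  simp only [mink, Pi.sub_apply, sub_mul, Finset.sum_sub_distrib]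
  ring

theorem mink_add_right {n : ℕ} (x y z : Fin (n + 1) → ℝ) :
    mink x (y + z) = mink x y + mink x z := by
  rw [mink_comm, mink_add_left, mink_comm y, mink_comm z]

theorem mink_smul_right {n : ℕ} (a : ℝ) (x y : Fin (n + 1) → ℝ) :
    mink x (a • y) = a * mink x y := by
  rw [mink_comm, mink_smul_left, mink_comm y]

theorem mink_munit_self {n : ℕ} {v : Fin (n + 1) → ℝ} (hv : mnorm v ≠ 0) :
    mink (munit v) (munit v) = 1 := by
  have h : mink v v = mnorm v ^ 2 :=
    (Real.sq_sqrt (Real.sqrt_ne_zero'.mp hv).le).symm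
  rw [munit, mink_smul_left, mink_smul_right, h]
  field_simp

theorem hasDerivAt_cosh_mul (m t : ℝ) :
    HasDerivAt (fun s => Real.cosh (m * s)) (m * Real.sinh (m * t)) t := by
  simpa [mul_comm] using ((hasDerivAt_id t).const_mul m).cosh

theorem hasDerivAt_sinh_mul (m t : ℝ) :
    HasDerivAt (fun s => Real.sinh (m * s)) (m * Real.cosh (m * t)) t := by
  simpa [mul_comm] using ((hasDerivAt_id t).const_mul m).sinh

theorem hasDerivAt_geo {n : ℕ} (p v : Fin (n + 1) → ℝ) (t : ℝ) :
    HasDerivAt (geo p v) (geo' p v t) t :=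
  ((hasDerivAt_cosh_mul _ t).smul_const p).add ((hasDerivAt_sinh_mul _ t).smul_const (munit v))

theorem hasDerivAt_ptransp {n : ℕ} (p v w : Fin (n + 1) → ℝ) (t : ℝ) :
    HasDerivAt (ptransp p v w) ((mink w (munit v) * mnorm v) • geo p v t) t := by
  have h := (((((hasDerivAt_sinh_mul (mnorm v) t).smul_const p).add
    ((hasDerivAt_cosh_mul (mnorm v) t).smul_const (munit v))).const_smul
      (mink w (munit v))).add_const w).sub_const (mink w (munit v) • munit v)
  refine h.congr_deriv ?_
  simp only [geo, smul_add, smul_smul, mul_assoc]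

theorem mink_ptransp_geo' {n : ℕ} {p v w : Fin (n + 1) → ℝ} (hp : p ∈ Hyperboloid n)
    (hv : v ∈ Tangent p) (hw : w ∈ Tangent p) (t : ℝ) :
    mink (ptransp p v w t) (geo' p v t) = mink w (munit v) * mnorm v := by
  by_cases hm : mnorm v = 0
  · simp [geo', hm, mink]
  have hpp : mink p p = -1 := hp.1
  have hwp : mink w p = 0 := hw
  have hup : mink (munit v) p = 0 := by
    rw [munit, mink_smul_left, show mink v p = 0 from hv, mul_zero]
  have hpu : mink p (munit v) = 0 := by rw [mink_comm, hup]
  simp only [ptransp, geo', mink_add_left, mink_sub_left, mink_smul_left, mink_add_right,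
    mink_smul_right, hpp, hwp, hup, hpu, mink_munit_self hm]
  linear_combination mink w (munit v) * mnorm v * Real.cosh_sq_sub_sinh_sq (mnorm v * t)

/-- Theorem 1 of the paper: X(t) = φ_t(w) is parallel along the geodesic γ_{p,v},
i.e. its covariant derivative X'(t) − ⟨X(t), γ'(t)⟩_M·γ(t) vanishes. -/
theorem ptransp_parallel {n : ℕ} (hn : 1 ≤ n)
    (p : Fin (n + 1) → ℝ) (hp : p ∈ Hyperboloid n)
    (v : Fin (n + 1) → ℝ) (hv : v ∈ Tangent p) (hv0 : v ≠ 0)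
    (w : Fin (n + 1) → ℝ) (hw : w ∈ Tangent p) (t : ℝ) :
    deriv (ptransp p v w) t
      - mink (ptransp p v w t) (deriv (geo p v) t) • geo p v t = 0 := by
  rw [(hasDerivAt_ptransp p v w t).deriv, (hasDerivAt_geo p v t).deriv,
    mink_ptransp_geo' hp hv hw, sub_self]
end
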